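/- arXiv:1507.05233 — 2 statements merged into one kernel-verified Lean document; each statement's English description precedes it below -/
import Mathlib

section
/- Let N, m be positive integers, A1, A2 left-stochastic N×N real matrices, R_1, …, R_N real symmetric positive definite m×m matrices, and μ_1, …, μ_N real numbers such that for every k, μ_k > 0 and μ_k·λ < 2 for every eigenvalue λ of R_k (equivalently 0 < μ_k < 2/λ_max(R_k)). Then the matrix powers ℬ^i converge entrywise to the zero matrix as i → ∞; in particular, for any x_{-1} ∈ ℝ^{Nm}, the sequence defined by x_i = ℬ x_{i-1} converges to zero. -/
open Matrix Filter Topology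
open scoped Kronecker BigOperators

/-- A real square matrix is left-stochastic if all its entries are nonnegative and
each of its columns sums to one. -/
def LeftStochastic {N : ℕ} (A : Matrix (Fin N) (Fin N) ℝ) : Prop :=
  (∀ i j, 0 ≤ A i j) ∧ ∀ j, ∑ i, A i j = 1

/-- Block-diagonal matrix with blocks `R 0, …, R (N-1)`. -/
def blockDiag {N m : ℕ} (R : Fin N → Matrix (Fin m) (Fin m) ℝ) :
    Matrix (Fin N × Fin m) (Fin N × Fin m) ℝ :=
  Matrix.of fun p q => if p.1 = q.1 then R p.1 p.2 q.2 else 0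

/-- The matrix ℬ = 𝒜₂ᵀ (I − ℳℛ) 𝒜₁ᵀ, where 𝒜₁ = A1 ⊗ I_m, 𝒜₂ = A2 ⊗ I_m,
ℛ = blockdiag(R₁,…,R_N) and ℳ = blockdiag(μ₁ I_m, …, μ_N I_m). -/
def calB {N m : ℕ} (A1 A2 : Matrix (Fin N) (Fin N) ℝ)
    (R : Fin N → Matrix (Fin m) (Fin m) ℝ) (μ : Fin N → ℝ) :
    Matrix (Fin N × Fin m) (Fin N × Fin m) ℝ :=
  (A2 ⊗ₖ (1 : Matrix (Fin m) (Fin m) ℝ))ᵀ *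
    (1 - blockDiag (fun k => μ k • (1 : Matrix (Fin m) (Fin m) ℝ)) * blockDiag R) *
    (A1 ⊗ₖ (1 : Matrix (Fin m) (Fin m) ℝ))ᵀ

/-- The `k`-th block of a block vector, as a Euclidean vector. -/
noncomputable def blockVec {N m : ℕ} (x : Fin N × Fin m → ℝ) (k : Fin N) :
    EuclideanSpace ℝ (Fin m) :=
  WithLp.toLp 2 fun a => x (k, a)

theorem blockVec_kronecker_transpose_mulVec {N m : ℕ} (A : Matrix (Fin N) (Fin N) ℝ)
    (x : Fin N × Fin m → ℝ) (k : Fin N) :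
    blockVec ((A ⊗ₖ (1 : Matrix (Fin m) (Fin m) ℝ))ᵀ *ᵥ x) k = ∑ j, A j k • blockVec x j := by
  ext a
  simp [blockVec, mulVec, dotProduct, Fintype.sum_prod_type, kroneckerMap_apply, one_apply]

theorem LeftStochastic.norm_blockVec_le {N m : ℕ} {A : Matrix (Fin N) (Fin N) ℝ}
    (hA : LeftStochastic A) {x : Fin N × Fin m → ℝ} {C : ℝ} (hx : ∀ k, ‖blockVec x k‖ ≤ C)
    (k : Fin N) :
    ‖blockVec ((A ⊗ₖ (1 : Matrix (Fin m) (Fin m) ℝ))ᵀ *ᵥ x) k‖ ≤ C := by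
  rw [blockVec_kronecker_transpose_mulVec]
  calc ‖∑ j, A j k • blockVec x j‖ ≤ ∑ j, A j k * C := by
        refine norm_sum_le_of_le _ fun j _ => ?_
        rw [norm_smul, Real.norm_of_nonneg (hA.1 j k)]
        exact mul_le_mul_of_nonneg_left (hx j) (hA.1 j k)
    _ = C := by rw [← Finset.sum_mul, hA.2, one_mul]

theorem blockDiag_mul_blockDiag {N m : ℕ} (R S : Fin N → Matrix (Fin m) (Fin m) ℝ) :
    blockDiag R * blockDiag S = blockDiag fun k => R k * S k := by
  ext ⟨k, a⟩ ⟨l, b⟩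
  by_cases h : k = l <;>
    simp [_root_.blockDiag, mul_apply, Fintype.sum_prod_type, h, Finset.sum_ite_irrel]

theorem blockVec_one_sub_blockDiag_mulVec {N m : ℕ} (R : Fin N → Matrix (Fin m) (Fin m) ℝ)
    (μ : Fin N → ℝ) (x : Fin N × Fin m → ℝ) (k : Fin N) :
    blockVec ((1 - blockDiag (fun k => μ k • (1 : Matrix (Fin m) (Fin m) ℝ)) * blockDiag R) *ᵥ x) k
      = blockVec x k - μ k • toEuclideanLin (R k) (blockVec x k) := by
  rw [blockDiag_mul_blockDiag]
  ext a
  rw [sub_mulVec, one_mulVec]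
  simp [blockVec, _root_.blockDiag, mulVec, dotProduct, Fintype.sum_prod_type,
    Finset.sum_ite_irrel, Finset.mul_sum, mul_assoc]

theorem Matrix.IsHermitian.norm_sub_smul_toEuclideanLin_le {m : ℕ}
    {R : Matrix (Fin m) (Fin m) ℝ} (hR : R.IsHermitian) {μ c : ℝ} (hc : 0 ≤ c)
    (h : ∀ i, |1 - μ * hR.eigenvalues i| ≤ c) (v : EuclideanSpace ℝ (Fin m)) :
    ‖v - μ • toEuclideanLin R v‖ ≤ c * ‖v‖ := by
  have key : ∀ i, inner ℝ (hR.eigenvectorBasis i) (v - μ • toEuclideanLin R v)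
      = (1 - μ * hR.eigenvalues i) * inner ℝ (hR.eigenvectorBasis i) v := by
    intro i
    have hs : (toEuclideanLin R).IsSymmetric := isSymmetric_toEuclideanLin_iff.2 hR
    have he : toEuclideanLin R (hR.eigenvectorBasis i)
        = hR.eigenvalues i • hR.eigenvectorBasis i := by
      ext a
      simpa using congrFun (hR.mulVec_eigenvectorBasis i) a
    rw [inner_sub_right, inner_smul_right, ← hs, he, real_inner_smul_left]
    ring
  refine (sq_le_sq₀ (norm_nonneg _) (by positivity)).1 ?_
  rw [mul_pow, ← hR.eigenvectorBasis.sum_sq_norm_inner_right,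
    ← hR.eigenvectorBasis.sum_sq_norm_inner_right v, Finset.mul_sum]
  refine Finset.sum_le_sum fun i _ => ?_
  rw [key, norm_mul, mul_pow, Real.norm_eq_abs (1 - _)]
  gcongr
  exact h i

theorem norm_blockVec_calB_mulVec_le {N m : ℕ} {A1 A2 : Matrix (Fin N) (Fin N) ℝ}
    (hA1 : LeftStochastic A1) (hA2 : LeftStochastic A2)
    {R : Fin N → Matrix (Fin m) (Fin m) ℝ} {μ : Fin N → ℝ} {c : ℝ} (hc : 0 ≤ c)
    (h : ∀ k (v : EuclideanSpace ℝ (Fin m)), ‖v - μ k • toEuclideanLin (R k) v‖ ≤ c * ‖v‖)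
    {x : Fin N × Fin m → ℝ} {C : ℝ} (hx : ∀ k, ‖blockVec x k‖ ≤ C) (k : Fin N) :
    ‖blockVec (calB A1 A2 R μ *ᵥ x) k‖ ≤ c * C := by
  rw [calB, ← mulVec_mulVec, ← mulVec_mulVec]
  refine hA2.norm_blockVec_le (fun l => ?_) k
  rw [blockVec_one_sub_blockDiag_mulVec]
  exact (h l _).trans (mul_le_mul_of_nonneg_left (hA1.norm_blockVec_le hx l) hc)

theorem tendsto_calB_pow_mulVec {N m : ℕ} {A1 A2 : Matrix (Fin N) (Fin N) ℝ}
    (hA1 : LeftStochastic A1) (hA2 : LeftStochastic A2)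
    {R : Fin N → Matrix (Fin m) (Fin m) ℝ} {μ : Fin N → ℝ} {c : ℝ} (hc : 0 ≤ c) (hc1 : c < 1)
    (h : ∀ k (v : EuclideanSpace ℝ (Fin m)), ‖v - μ k • toEuclideanLin (R k) v‖ ≤ c * ‖v‖)
    (x : Fin N × Fin m → ℝ) :
    Tendsto (fun i : ℕ => (calB A1 A2 R μ ^ i) *ᵥ x) atTop (𝓝 0) := by
  have bound : ∀ i k, ‖blockVec ((calB A1 A2 R μ ^ i) *ᵥ x) k‖
      ≤ c ^ i * ∑ l, ‖blockVec x l‖ := by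
    intro i
    induction i with
    | zero =>
      intro k
      simpa using Finset.single_le_sum (f := fun l => ‖blockVec x l‖)
        (fun l _ => norm_nonneg _) (Finset.mem_univ k)
    | succ i ih =>
      intro k
      rw [pow_succ', pow_succ', ← mulVec_mulVec, mul_assoc]
      exact norm_blockVec_calB_mulVec_le hA1 hA2 hc h ih k
  rw [tendsto_pi_nhds]
  rintro ⟨k, a⟩
  refine squeeze_zero_norm
    (fun i => (PiLp.norm_apply_le (blockVec ((calB A1 A2 R μ ^ i) *ᵥ x) k) a).trans (bound i k)) ?_
  simpa using (tendsto_pow_atTop_nhds_zero_of_lt_one hc hc1).mul_const (∑ l, ‖blockVec x l‖)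

theorem stmt0 {N m : ℕ} (hN : 0 < N) (hm : 0 < m)
    (A1 A2 : Matrix (Fin N) (Fin N) ℝ)
    (hA1 : LeftStochastic A1) (hA2 : LeftStochastic A2)
    (R : Fin N → Matrix (Fin m) (Fin m) ℝ)
    (hR : ∀ k, (R k).PosDef)
    (μ : Fin N → ℝ) (hμ : ∀ k, 0 < μ k)
    (hμR : ∀ k, ∀ lam ∈ spectrum ℝ (R k), μ k * lam < 2) :
    Tendsto (fun i : ℕ => calB A1 A2 R μ ^ i) atTop (𝓝 0) ∧
      ∀ x : Fin N × Fin m → ℝ,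
        Tendsto (fun i : ℕ => (calB A1 A2 R μ ^ i) *ᵥ x) atTop (𝓝 0) := by
  obtain ⟨c, hc, hc1, hbound⟩ : ∃ c : ℝ, 0 ≤ c ∧ c < 1 ∧
      ∀ k i, |1 - μ k * (hR k).isHermitian.eigenvalues i| ≤ c := by
    have : Nonempty (Fin N × Fin m) := ⟨⟨0, hN⟩, ⟨0, hm⟩⟩
    obtain ⟨p, hp⟩ := Finite.exists_max fun p : Fin N × Fin m =>
      |1 - μ p.1 * (hR p.1).isHermitian.eigenvalues p.2|
    refine ⟨_, abs_nonneg _, ?_, fun k i => hp (k, i)⟩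
    have hpos := mul_pos (hμ p.1) ((hR p.1).eigenvalues_pos p.2)
    have hlt := hμR p.1 _ ((hR p.1).isHermitian.eigenvalues_mem_spectrum_real p.2)
    rw [abs_lt]
    constructor <;> linarith
  have hx := tendsto_calB_pow_mulVec hA1 hA2 hc hc1 fun k v =>
    (hR k).isHermitian.norm_sub_smul_toEuclideanLin_le hc (hbound k) v
  refine ⟨?_, hx⟩
  refine tendsto_pi_nhds.2 fun p => tendsto_pi_nhds.2 fun q => ?_
  simpa using tendsto_pi_nhds.1 (hx (Pi.single q 1)) p
end

section
/- Let N, m be positive integers, A1, A2 left-stochastic N×N real matrices, R_1, …, R_N real symmetric positive semidefinite m×m matrices, and μ_1, …, μ_N real numbers such that for every k, μ_k > 0 and μ_k·λ < 2 for every eigenvalue λ of R_k. Then for every integer i ≥ 0 and every x ∈ ℝ^{Nm}, ‖ℬ^i x‖_{b,∞} ≤ (max_{1≤k≤N} ρ(I_m − μ_k R_k))^i · ‖x‖_{b,∞} ≤ ‖x‖_{b,∞}; in particular the sequence x_i = ℬ x_{i-1} remains bounded in block-maximum norm by ‖x_{-1}‖_{b,∞} for all i. -/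
open Matrix Filter Topology
open scoped Kronecker BigOperators

/-- The spectral radius of a real (symmetric) matrix: the largest absolute value of
its real eigenvalues. -/
noncomputable def specRad {m : ℕ} (D : Matrix (Fin m) (Fin m) ℝ) : ℝ :=
  sSup ((fun lam => |lam|) '' spectrum ℝ D)

/-- The block-maximum norm of a vector in ℝ^(Nm): the maximum over the N blocks of
the Euclidean norm of each block. -/
noncomputable def blockMaxNorm {N m : ℕ} (x : Fin N × Fin m → ℝ) : ℝ :=
  ⨆ k : Fin N, Real.sqrt (∑ j, (x (k, j)) ^ 2)

theorem sqrt_sum_sq_eq_norm {n : Type*} [Fintype n] (v : n → ℝ) :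
    Real.sqrt (∑ j, v j ^ 2) = ‖WithLp.toLp 2 v‖ := by
  simp [EuclideanSpace.norm_eq]

theorem norm_block_le_blockMaxNorm {N m : ℕ} (x : Fin N × Fin m → ℝ) (k : Fin N) :
    ‖WithLp.toLp 2 fun j => x (k, j)‖ ≤ blockMaxNorm x := by
  rw [← sqrt_sum_sq_eq_norm]
  exact le_ciSup (f := fun k => Real.sqrt (∑ j, x (k, j) ^ 2)) (Set.finite_range _).bddAbove k

theorem blockMaxNorm_le {N m : ℕ} {x : Fin N × Fin m → ℝ} {c : ℝ} (hc : 0 ≤ c)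
    (h : ∀ k, ‖WithLp.toLp 2 fun j => x (k, j)‖ ≤ c) : blockMaxNorm x ≤ c :=
  Real.iSup_le (fun k => (sqrt_sum_sq_eq_norm _).trans_le (h k)) hc

theorem blockMaxNorm_nonneg {N m : ℕ} (x : Fin N × Fin m → ℝ) : 0 ≤ blockMaxNorm x :=
  Real.iSup_nonneg fun _ => Real.sqrt_nonneg _

/-- The transpose of `A ⊗ I`, with `A` left-stochastic, averages the blocks of a vector. -/
theorem LeftStochastic.blockMaxNorm_kronecker_transpose_mulVec_le {N m : ℕ}
    {A : Matrix (Fin N) (Fin N) ℝ} (hA : LeftStochastic A) (x : Fin N × Fin m → ℝ) :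
    blockMaxNorm ((A ⊗ₖ (1 : Matrix (Fin m) (Fin m) ℝ))ᵀ *ᵥ x) ≤ blockMaxNorm x := by
  refine blockMaxNorm_le (blockMaxNorm_nonneg x) fun k => ?_
  have hblock : (WithLp.toLp 2 fun j =>
      ((A ⊗ₖ (1 : Matrix (Fin m) (Fin m) ℝ))ᵀ *ᵥ x) (k, j)) =
      ∑ l, A l k • WithLp.toLp 2 fun j => x (l, j) := by
    ext j
    simp [Matrix.mulVec, dotProduct, Fintype.sum_prod_type, Matrix.one_apply]
  rw [hblock]
  calc ‖∑ l, A l k • WithLp.toLp 2 fun j => x (l, j)‖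
      ≤ ∑ l, A l k * blockMaxNorm x := norm_sum_le_of_le _ fun l _ => by
        rw [norm_smul, Real.norm_of_nonneg (hA.1 l k)]
        exact mul_le_mul_of_nonneg_left (norm_block_le_blockMaxNorm x l) (hA.1 l k)
    _ = blockMaxNorm x := by rw [← Finset.sum_mul, hA.2 k, one_mul]

theorem specRad_nonneg {m : ℕ} (D : Matrix (Fin m) (Fin m) ℝ) : 0 ≤ specRad D :=
  Real.sSup_nonneg (by rintro _ ⟨_, _, rfl⟩; exact abs_nonneg _)

theorem abs_le_specRad {m : ℕ} {D : Matrix (Fin m) (Fin m) ℝ} {η : ℝ}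
    (h : η ∈ spectrum ℝ D) : |η| ≤ specRad D :=
  le_csSup ((Matrix.finite_real_spectrum (A := D)).image _).bddAbove ⟨η, h, rfl⟩

theorem norm_mulVec_le_specRad_mul {m : ℕ} {D : Matrix (Fin m) (Fin m) ℝ}
    (hD : D.IsHermitian) (v : Fin m → ℝ) :
    ‖WithLp.toLp 2 (D *ᵥ v)‖ ≤ specRad D * ‖WithLp.toLp 2 v‖ := by
  refine le_of_sq_le_sq ?_ (mul_nonneg (specRad_nonneg D) (norm_nonneg _))
  rw [mul_pow, ← hD.eigenvectorBasis.sum_sq_norm_inner_right,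
    ← hD.eigenvectorBasis.sum_sq_norm_inner_right, Finset.mul_sum]
  refine Finset.sum_le_sum fun i _ => ?_
  have hinner : inner ℝ (hD.eigenvectorBasis i) (WithLp.toLp 2 (D *ᵥ v)) =
      hD.eigenvalues i * inner ℝ (hD.eigenvectorBasis i) (WithLp.toLp 2 v) := by
    have hsymm : Dᵀ = D := by simpa [Matrix.IsHermitian] using hD
    have hv := hD.mulVec_eigenvectorBasis i
    simp only [EuclideanSpace.inner_eq_star_dotProduct, star_trivial]
    rw [dotProduct_comm, Matrix.dotProduct_mulVec, ← Matrix.mulVec_transpose, hsymm, hv,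
      smul_dotProduct, smul_eq_mul, dotProduct_comm]
  rw [hinner, norm_mul, mul_pow, Real.norm_eq_abs]
  gcongr
  exact abs_le_specRad (hD.eigenvalues_mem_spectrum_real i)

theorem specRad_one_sub_smul_le_one {m : ℕ} {R : Matrix (Fin m) (Fin m) ℝ}
    (hR : R.PosSemidef) {μ : ℝ} (hμ : 0 < μ) (h : ∀ lam ∈ spectrum ℝ R, μ * lam < 2) :
    specRad (1 - μ • R) ≤ 1 := by
  refine Real.sSup_le ?_ zero_le_one
  rintro _ ⟨η, hη, rfl⟩
  rw [← map_one (algebraMap ℝ (Matrix (Fin m) (Fin m) ℝ)), ← spectrum.singleton_sub_eq] at hη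
  obtain ⟨_, rfl, ν, hν, rfl⟩ := Set.mem_sub.1 hη
  rw [show μ • R = Units.mk0 μ hμ.ne' • R from rfl, spectrum.unit_smul_eq_smul] at hν
  obtain ⟨lam, hlam, rfl⟩ := hν
  have hlam_nonneg : 0 ≤ lam :=
    (Matrix.posSemidef_iff_isHermitian_and_spectrum_nonneg.1 hR).2 hlam
  have hlt := h lam hlam
  have hnonneg := mul_nonneg hμ.le hlam_nonneg
  simp only [Units.val_mk0, smul_eq_mul, abs_le]
  constructor <;> linarith

theorem blockDiag_mulVec_apply {N m : ℕ} (R : Fin N → Matrix (Fin m) (Fin m) ℝ)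
    (x : Fin N × Fin m → ℝ) (k : Fin N) (j : Fin m) :
    (_root_.blockDiag R *ᵥ x) (k, j) = (R k *ᵥ fun i => x (k, i)) j := by
  simp [_root_.blockDiag, Matrix.mulVec, dotProduct, Fintype.sum_prod_type]

theorem block_one_sub_mulVec {N m : ℕ} (R : Fin N → Matrix (Fin m) (Fin m) ℝ)
    (μ : Fin N → ℝ) (x : Fin N × Fin m → ℝ) (k : Fin N) :
    (fun j => ((1 - _root_.blockDiag (fun k => μ k • (1 : Matrix (Fin m) (Fin m) ℝ)) *
      _root_.blockDiag R) *ᵥ x) (k, j)) = (1 - μ k • R k) *ᵥ fun j => x (k, j) := by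
  ext j
  simp [Matrix.sub_mulVec, ← Matrix.mulVec_mulVec, Matrix.smul_mulVec, blockDiag_mulVec_apply]

theorem blockMaxNorm_calB_mulVec_le {N m : ℕ} {A1 A2 : Matrix (Fin N) (Fin N) ℝ}
    (hA1 : LeftStochastic A1) (hA2 : LeftStochastic A2)
    {R : Fin N → Matrix (Fin m) (Fin m) ℝ} (hR : ∀ k, (R k).IsHermitian)
    (μ : Fin N → ℝ) (x : Fin N × Fin m → ℝ) :
    blockMaxNorm (calB A1 A2 R μ *ᵥ x) ≤
      (⨆ k, specRad (1 - μ k • R k)) * blockMaxNorm x := by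
  have hρ : 0 ≤ ⨆ k, specRad (1 - μ k • R k) := Real.iSup_nonneg fun _ => specRad_nonneg _
  rw [calB, ← Matrix.mulVec_mulVec, ← Matrix.mulVec_mulVec]
  refine (hA2.blockMaxNorm_kronecker_transpose_mulVec_le _).trans
    ((blockMaxNorm_le (mul_nonneg hρ (blockMaxNorm_nonneg _)) fun k => ?_).trans
      (mul_le_mul_of_nonneg_left (hA1.blockMaxNorm_kronecker_transpose_mulVec_le x) hρ))
  rw [block_one_sub_mulVec]
  have hD : (1 - μ k • R k).IsHermitian :=
    Matrix.isHermitian_one.sub ((hR k).smul (IsSelfAdjoint.all (μ k)))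
  exact (norm_mulVec_le_specRad_mul hD _).trans (mul_le_mul
    (le_ciSup (f := fun k => specRad (1 - μ k • R k)) (Set.finite_range _).bddAbove k)
    (norm_block_le_blockMaxNorm _ k) (norm_nonneg _) hρ)

theorem stmt4 {N m : ℕ} (hN : 0 < N) (hm : 0 < m)
    (A1 A2 : Matrix (Fin N) (Fin N) ℝ)
    (hA1 : LeftStochastic A1) (hA2 : LeftStochastic A2)
    (R : Fin N → Matrix (Fin m) (Fin m) ℝ)
    (hR : ∀ k, (R k).PosSemidef)
    (μ : Fin N → ℝ) (hμ : ∀ k, 0 < μ k)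
    (hμR : ∀ k, ∀ lam ∈ spectrum ℝ (R k), μ k * lam < 2) :
    ∀ (i : ℕ) (x : Fin N × Fin m → ℝ),
      blockMaxNorm ((calB A1 A2 R μ ^ i) *ᵥ x) ≤
        (⨆ k : Fin N, specRad ((1 : Matrix (Fin m) (Fin m) ℝ) - μ k • R k)) ^ i *
          blockMaxNorm x ∧
      (⨆ k : Fin N, specRad ((1 : Matrix (Fin m) (Fin m) ℝ) - μ k • R k)) ^ i *
          blockMaxNorm x ≤ blockMaxNorm x := by
  intro i x
  have hρ : 0 ≤ ⨆ k, specRad (1 - μ k • R k) := Real.iSup_nonneg fun _ => specRad_nonneg _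
  have hρ_le : ⨆ k, specRad (1 - μ k • R k) ≤ 1 :=
    Real.iSup_le (fun k => specRad_one_sub_smul_le_one (hR k) (hμ k) (hμR k)) zero_le_one
  refine ⟨?_, mul_le_of_le_one_left (blockMaxNorm_nonneg x) (pow_le_one₀ hρ hρ_le)⟩
  induction i with
  | zero => simp
  | succ n ih =>
    rw [pow_succ', ← Matrix.mulVec_mulVec, pow_succ', mul_assoc]
    exact (blockMaxNorm_calB_mulVec_le hA1 hA2 (fun k => (hR k).isHermitian) μ _).trans
      (mul_le_mul_of_nonneg_left ih hρ)
end
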